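/- For every λ > 0 there exists δ ≥ 0 such that every bounded open convex subset C of ℝ² with λ₁(C) ≥ λ is δ-hyperbolic for its Hilbert metric d_C. -/

import Mathlib

open MeasureTheory Set Filter
open scoped ENNReal NNReal

noncomputable section

/-- Euclidean `n`-space. -/
abbrev Euc (n : ℕ) : Type := EuclideanSpace ℝ (Fin n)

/-- The set of parameters `t` such that `p + t • v` lies in `C`. For `C` open bounded
convex, `p ∈ C` and `v ≠ 0` this is an open interval `(t⁻, t⁺)` with `t⁻ < 0 < t⁺`;
the points `p + t⁻ • v` and `p + t⁺ • v` are the two intersections of the boundary `∂C`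
with the line through `p` directed by `v`. -/
def lineParams {n : ℕ} (C : Set (Euc n)) (p v : Euc n) : Set ℝ := {t : ℝ | p + t • v ∈ C}

open Classical in
/-- The Hilbert distance of the convex set `C`: with `a = p + t⁻ • (q - p)` and
`b = p + t⁺ • (q - p)` the two boundary points (so that `a, p, q, b` are in this order),
the cross-ratio `(‖q-a‖ ‖p-b‖)/(‖p-a‖ ‖q-b‖)` equals `((1 - t⁻) t⁺)/((-t⁻)(t⁺ - 1))`. -/
def hDist {n : ℕ} (C : Set (Euc n)) (p q : Euc n) : ℝ :=
  if p = q then 0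
  else
    (1 / 2) * Real.log
      (((1 - sInf (lineParams C p (q - p))) * sSup (lineParams C p (q - p))) /
        ((-sInf (lineParams C p (q - p))) * (sSup (lineParams C p (q - p)) - 1)))

open Classical in
/-- The Hilbert Finsler norm of `u` at `p`: with `p⁺ = p + t⁺ • u`, `p⁻ = p + t⁻ • u`
the two boundary points on the line through `p` directed by `u`, one has
`(1/2)‖u‖(1/‖p-p⁺‖ + 1/‖p-p⁻‖) = (1/2)(1/t⁺ - 1/t⁻)`. -/
def fNorm {n : ℕ} (C : Set (Euc n)) (p u : Euc n) : ℝ :=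
  if u = 0 then 0
  else (1 / 2) * (1 / sSup (lineParams C p u) - 1 / sInf (lineParams C p u))

/-- The dual norm of a linear form `l` at `p`: `sup {l u : ‖u‖_{C,p} = 1}`. -/
def dualNorm {n : ℕ} (C : Set (Euc n)) (p : Euc n) (l : Euc n →L[ℝ] ℝ) : ℝ :=
  sSup ((fun u => l u) '' {u : Euc n | fNorm C p u = 1})

/-- The tangent ball `TB_R(p) = {u : ‖u‖_{C,p} < R}`. -/
def tangentBall {n : ℕ} (C : Set (Euc n)) (p : Euc n) (R : ℝ) : Set (Euc n) :=
  {u : Euc n | fNorm C p u < R}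

/-- `ωₙ`, the Lebesgue volume of the Euclidean unit ball of `ℝⁿ`. -/
def omegaVol (n : ℕ) : ℝ := (volume (Metric.ball (0 : Euc n) 1)).toReal

/-- The Hilbert (Busemann) measure of `C`: density `ωₙ / vol_e(TB_C(p))` against
Lebesgue measure, supported on `C`. -/
def hMeasure {n : ℕ} (C : Set (Euc n)) : Measure (Euc n) :=
  (volume.restrict C).withDensity fun p =>
    ENNReal.ofReal (omegaVol n / (volume (tangentBall C p 1)).toReal)

/-- Admissible test functions: nonzero Lipschitz functions with compact support
contained in `Ω`. -/
def testFuns {n : ℕ} (Ω : Set (Euc n)) : Set (Euc n → ℝ) :=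
  {f : Euc n → ℝ |
    (∃ K : ℝ≥0, LipschitzWith K f) ∧ f ≠ 0 ∧ HasCompactSupport f ∧ tsupport f ⊆ Ω}

/-- The Rayleigh quotient of `f` on `Ω`, with respect to the Hilbert geometry of `C`
(`df` is the a.e.-defined differential of the Lipschitz function `f`). -/
def rayleigh {n : ℕ} (C Ω : Set (Euc n)) (f : Euc n → ℝ) : ℝ :=
  (∫ p in Ω, dualNorm C p (fderiv ℝ f p) ^ 2 ∂hMeasure C) /
    ∫ p in Ω, f p ^ 2 ∂hMeasure C

/-- The Dirichlet bottom of the spectrum `λ₁^C(Ω)`. -/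
def lambda1D {n : ℕ} (C Ω : Set (Euc n)) : ℝ := sInf (rayleigh C Ω '' testFuns Ω)

/-- The bottom of the spectrum `λ₁(C)` of the Hilbert geometry of `C`. -/
def lambda1 {n : ℕ} (C : Set (Euc n)) : ℝ := lambda1D C C

/-- The Gromov product `(x|y)_t = (d(x,t) + d(y,t) - d(x,y))/2`. -/
def gromovProd {n : ℕ} (d : Euc n → Euc n → ℝ) (x y t : Euc n) : ℝ :=
  (d x t + d y t - d x y) / 2

/-- `(C, d_C)` is `δ`-hyperbolic: for all `x y z t` in `C`,
`(x|y)_t ≥ min((x|z)_t, (y|z)_t) - δ`. -/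
def IsDeltaHyp {n : ℕ} (C : Set (Euc n)) (δ : ℝ) : Prop :=
  ∀ x ∈ C, ∀ y ∈ C, ∀ z ∈ C, ∀ t ∈ C,
    gromovProd (hDist C) x y t ≥
      min (gromovProd (hDist C) x z t) (gromovProd (hDist C) y z t) - δ

/-- The metric ball `B_R(x)` of the Hilbert metric of `C`. -/
def hBall {n : ℕ} (C : Set (Euc n)) (x : Euc n) (R : ℝ) : Set (Euc n) :=
  {y ∈ C | hDist C x y < R}

/-- The image of `C` under the homothety of center `P₀` and ratio `r`. -/
def homoth {n : ℕ} (P₀ : Euc n) (r : ℝ) (C : Set (Euc n)) : Set (Euc n) :=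
  (fun x => P₀ + r • (x - P₀)) '' C

/-- Diameter of a set with respect to a distance function `d`. -/
def ediamD {α : Type*} (d : α → α → ℝ) (S : Set α) : ℝ≥0∞ :=
  ⨆ x ∈ S, ⨆ y ∈ S, ENNReal.ofReal (d x y)

/-- The `k`-dimensional Hausdorff measure of `S` with respect to the distance
function `d`. -/
def hausD {α : Type*} (k : ℝ) (d : α → α → ℝ) (S : Set α) : ℝ≥0∞ :=
  ⨆ (ε : ℝ≥0∞) (_ : 0 < ε),
    ⨅ (U : ℕ → Set α) (_ : S ⊆ ⋃ i, U i) (_ : ∀ i, ediamD d (U i) ≤ ε),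
      ∑' i, ediamD d (U i) ^ k

/-- The frontier of `U` is a rectifiable closed curve (for the Hilbert metric of `C`):
it is the image of a closed continuous curve and has finite one-dimensional Hausdorff
measure. -/
def RectCurveBoundary (C U : Set (Euc 2)) : Prop :=
  ∃ c : ℝ → Euc 2, ContinuousOn c (Icc 0 1) ∧ c '' Icc (0 : ℝ) 1 = frontier U ∧
    c 0 = c 1 ∧ hausD 1 (hDist C) (frontier U) < ⊤

/-- The Cheeger constant `I_∞^C(Ω)` in dimension `2`: infimum of
`ν_C(∂U)/μ_C(U)` over open sets `U` with closure contained in `Ω` whose boundary is a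
rectifiable curve, `ν_C` being the `1`-dimensional Hausdorff measure of `(C, d_C)`. -/
def cheeger2D (C Ω : Set (Euc 2)) : ℝ :=
  sInf {r : ℝ | ∃ U : Set (Euc 2), IsOpen U ∧ U.Nonempty ∧ closure U ⊆ Ω ∧
    RectCurveBoundary C U ∧
    r = (hausD 1 (hDist C) (frontier U)).toReal / (hMeasure C U).toReal}

/-- The Cheeger constant `I_∞(C)` of a planar Hilbert geometry. -/
def cheeger2 (C : Set (Euc 2)) : ℝ := cheeger2D C C

/-- `S` is a `C¹` hypersurface: near each of its points it is the zero set of a `C¹`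
function with nonvanishing differential. -/
def IsC1Hypersurface {n : ℕ} (S : Set (Euc n)) : Prop :=
  ∀ x ∈ S, ∃ (f : Euc n → ℝ) (U : Set (Euc n)), U ∈ nhds x ∧ ContDiffOn ℝ 1 f U ∧
    (∀ y ∈ U, fderiv ℝ f y ≠ 0) ∧ S ∩ U = {y ∈ U | f y = 0}

/-- The Cheeger constant `I_∞^C(Ω)` in dimension `n`: infimum of `ν_C(∂U)/μ_C(U)` over
open sets `U` with closure contained in `Ω` whose boundary is a `C¹` hypersurface,
`ν_C` being the `(n-1)`-dimensional Hausdorff measure of `(C, d_C)`. -/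
def cheegerND {n : ℕ} (C Ω : Set (Euc n)) : ℝ :=
  sInf {r : ℝ | ∃ U : Set (Euc n), IsOpen U ∧ U.Nonempty ∧ closure U ⊆ Ω ∧
    IsC1Hypersurface (frontier U) ∧
    r = (hausD ((n : ℝ) - 1) (hDist C) (frontier U)).toReal / (hMeasure C U).toReal}

/-- The boundary of the convex set `C` is of class `C¹`: through each boundary point
passes a unique supporting hyperplane. -/
def HasC1Boundary {n : ℕ} (C : Set (Euc n)) : Prop :=
  ∀ x ∈ frontier C, ∃! l : Euc n →L[ℝ] ℝ, ‖l‖ = 1 ∧ ∀ y ∈ C, l y ≤ l x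

/-- The convex set `C` is strictly convex: the open segment joining two distinct
boundary points is contained in `C`. -/
def IsStrictlyConvexSet {n : ℕ} (C : Set (Euc n)) : Prop :=
  ∀ x ∈ frontier C, ∀ y ∈ frontier C, x ≠ y → openSegment ℝ x y ⊆ C

end



/-- `l + k` is a positive affine function on `C`. -/
def PA (C : Set (Euc 2)) (l : Euc 2 →L[ℝ] ℝ) (k : ℝ) : Prop := ∀ p ∈ C, 0 < l p + k

lemma PA_one (C : Set (Euc 2)) : PA C 0 1 := by
  intro p _; simp

lemma funk_exists {C : Set (Euc 2)} (hc : Convex ℝ C) (ho : IsOpen C)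
    (hb : Bornology.IsBounded C) {p v : Euc 2} (hp : p ∈ C) (hv : v ≠ 0) :
    ∃ Λ : ℝ, 0 < Λ ∧ sSup (lineParams C p v) = 1 / Λ ∧
      (∀ l k, PA C l k → - l v ≤ Λ * (l p + k)) ∧
      ∃ l k, PA C l k ∧ - l v = Λ * (l p + k) := by
  have hvn : 0 < ‖v‖ := norm_pos_iff.mpr hv
  have hopen : IsOpen (lineParams C p v) := by
    apply ho.preimage (f := fun t : ℝ => p + t • v)
    fun_prop
  have h0 : (0 : ℝ) ∈ lineParams C p v := by simp [lineParams, hp]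
  obtain ⟨D, hD⟩ := hb.exists_norm_le
  have hbd : BddAbove (lineParams C p v) := by
    refine ⟨(D + D) / ‖v‖, ?_⟩
    intro t ht
    rw [le_div_iff₀ hvn]
    have h1 : ‖t • v‖ ≤ D + D := by
      have : t • v = (p + t • v) - p := by abel
      rw [this]
      exact (norm_sub_le _ _).trans (add_le_add (hD _ ht) (hD _ hp))
    rw [norm_smul] at h1
    exact (mul_le_mul_of_nonneg_right (le_abs_self t) hvn.le).trans h1
  set τ := sSup (lineParams C p v) with hτ
  have hnot : τ ∉ lineParams C p v := by
    intro h
    obtain ⟨r, hr, hrs⟩ := Metric.isOpen_iff.mp hopen τ h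
    have : τ + r / 2 ∈ lineParams C p v := by
      apply hrs
      rw [Metric.mem_ball, Real.dist_eq]
      have : τ + r/2 - τ = r / 2 := by ring
      rw [this, abs_of_pos (by positivity)]
      linarith
    have := le_csSup hbd this
    linarith
  have hτ0 : 0 < τ := by
    have h1 : 0 ≤ τ := le_csSup hbd h0
    rcases h1.lt_or_eq with h | h
    · exact h
    · exact absurd (h ▸ h0) hnot
  have hge : ∀ l k, PA C l k → 0 ≤ l p + k + τ * l v := by
    intro l k hl
    by_contra! hneg
    have hlp := hl p hp
    have hlv : l v < 0 := by
      by_contra! h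
      nlinarith [mul_nonneg hτ0.le h]
    have : τ ≤ (l p + k) / (- l v) := by
      apply csSup_le ⟨0, h0⟩
      intro t ht
      have := hl _ ht
      simp only [map_add, map_smul, smul_eq_mul] at this
      rw [le_div_iff₀ (by linarith)]
      linarith
    rw [le_div_iff₀ (by linarith)] at this
    linarith
  refine ⟨1 / τ, by positivity, by simp, ?_, ?_⟩
  · intro l k hl
    have := hge l k hl
    rw [div_mul_eq_mul_div, le_div_iff₀ hτ0]
    linarith
  · obtain ⟨f, hf⟩ := geometric_hahn_banach_open_point hc ho (x := p + τ • v) hnot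
    refine ⟨-f, f (p + τ • v), ?_, ?_⟩
    · intro q hq
      have := hf q hq
      simp only [neg_apply]
      linarith
    · simp only [neg_apply, map_add, map_smul, smul_eq_mul]
      field_simp
      ring

lemma sInf_lp (C : Set (Euc 2)) (p v : Euc 2) :
    sInf (lineParams C p v) = - sSup (lineParams C p (-v)) := by
  rw [Real.sInf_def]
  congr 2
  ext t
  simp [lineParams]

/-- Finsler norm as a sup. -/
lemma fNorm_ge {C : Set (Euc 2)} (hc : Convex ℝ C) (ho : IsOpen C)
    (hb : Bornology.IsBounded C) {p v : Euc 2} (hp : p ∈ C) {l m : Euc 2 →L[ℝ] ℝ} {k j : ℝ}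
    (hl : PA C l k) (hm : PA C m j) :
    m v / (m p + j) - l v / (l p + k) ≤ 2 * fNorm C p v := by
  by_cases hv : v = 0
  · simp [fNorm, hv]
  obtain ⟨Λ, hΛ, h1, h2, -⟩ := funk_exists hc ho hb hp hv
  obtain ⟨Λ', hΛ', h1', h2', -⟩ := funk_exists hc ho hb hp (neg_ne_zero.mpr hv)
  have a1 := h2 l k hl
  have a2 := h2' m j hm
  have b1 := hl p hp
  have b2 := hm p hp
  rw [fNorm, if_neg hv, sInf_lp, h1, h1']
  have c1 : -l v / (l p + k) ≤ Λ := by rw [div_le_iff₀ b1]; exact a1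
  have c2 : m v / (m p + j) ≤ Λ' := by
    rw [div_le_iff₀ b2]; simpa using a2
  rw [neg_div] at c1
  simp only [div_neg, one_div, inv_inv]
  linarith

lemma fNorm_eq {C : Set (Euc 2)} (hc : Convex ℝ C) (ho : IsOpen C)
    (hb : Bornology.IsBounded C) {p : Euc 2} (v : Euc 2) (hp : p ∈ C) :
    ∃ (l m : Euc 2 →L[ℝ] ℝ) (k j : ℝ), PA C l k ∧ PA C m j ∧
    m v / (m p + j) - l v / (l p + k) = 2 * fNorm C p v := by
  by_cases hv : v = 0
  · exact ⟨0, 0, 1, 1, PA_one C, PA_one C, by simp [fNorm, hv]⟩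
  obtain ⟨Λ, hΛ, h1, -, l, k, hl, h2⟩ := funk_exists hc ho hb hp hv
  obtain ⟨Λ', hΛ', h1', -, m, j, hm, h2'⟩ := funk_exists hc ho hb hp (neg_ne_zero.mpr hv)
  refine ⟨l, m, k, j, hl, hm, ?_⟩
  have b1 := hl p hp
  have b2 := hm p hp
  rw [fNorm, if_neg hv, sInf_lp, h1, h1']
  have c1 : -l v / (l p + k) = Λ := by rw [div_eq_iff b1.ne']; exact h2
  have c2 : m v / (m p + j) = Λ' := by
    rw [div_eq_iff b2.ne']; simpa using h2'
  rw [neg_div] at c1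
  simp only [div_neg, one_div, inv_inv]
  linarith

/-- Extremal functionals along a line. -/
lemma hDist_attain {C : Set (Euc 2)} (hc : Convex ℝ C) (ho : IsOpen C)
    (hb : Bornology.IsBounded C) {p q : Euc 2} (hp : p ∈ C) (hq : q ∈ C) :
    ∃ (l m : Euc 2 →L[ℝ] ℝ) (k j : ℝ), PA C l k ∧ PA C m j ∧
      hDist C p q = (1/2) * Real.log (((l p + k) * (m q + j)) / ((l q + k) * (m p + j))) ∧
      (∀ l' k', PA C l' k' → - l' (q - p) * (l p + k) ≤ - l (q - p) * (l' p + k')) ∧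
      (∀ l' k', PA C l' k' → l' (q - p) * (m p + j) ≤ m (q - p) * (l' p + k')) := by
  by_cases hpq : p = q
  · refine ⟨0, 0, 1, 1, PA_one C, PA_one C, by simp [hDist, hpq], ?_, ?_⟩ <;> simp [hpq]
  have hv : q - p ≠ 0 := sub_ne_zero.mpr (Ne.symm hpq)
  obtain ⟨Λ, hΛ, h1, h3, l, k, hl, h2⟩ := funk_exists hc ho hb hp hv
  obtain ⟨Λ', hΛ', h1', h3', m, j, hm, h2'⟩ := funk_exists hc ho hb hp (neg_ne_zero.mpr hv)
  have b1 := hl p hp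
  have b2 := hm p hp
  have e1 := hl q hq
  have e2 := hm q hq
  refine ⟨l, m, k, j, hl, hm, ?_, ?_, ?_⟩
  · rw [hDist, if_neg hpq, sInf_lp, h1, h1']
    congr 2
    simp only [map_neg, map_sub, neg_neg] at h2 h2'
    have q1 : l q + k = (1 - Λ) * (l p + k) := by linarith
    have q2 : m q + j = (1 + Λ') * (m p + j) := by linarith
    have hL : 0 < 1 - Λ := by
      rw [q1] at e1
      exact (pos_iff_pos_of_mul_pos e1).mpr b1
    rw [q1, q2]
    have : 1 / Λ - 1 ≠ 0 := by
      have : 1 / Λ - 1 = (1 - Λ) / Λ := by field_simp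
      rw [this]; positivity
    field_simp
    ring
  · intro l' k' hl'
    have := h3 l' k' hl'
    rw [h2]
    nlinarith [mul_le_mul_of_nonneg_right this b1.le]
  · intro l' k' hl'
    have := h3' l' k' hl'
    simp only [map_neg, neg_neg] at this h2'
    rw [h2']
    nlinarith [mul_le_mul_of_nonneg_right this b2.le]

lemma hDist_ge {C : Set (Euc 2)} (hc : Convex ℝ C) (ho : IsOpen C)
    (hb : Bornology.IsBounded C) {p q : Euc 2} (hp : p ∈ C) (hq : q ∈ C)
    {l m : Euc 2 →L[ℝ] ℝ} {k j : ℝ} (hl : PA C l k) (hm : PA C m j) :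
    (1/2) * Real.log (((l p + k) * (m q + j)) / ((l q + k) * (m p + j))) ≤ hDist C p q := by
  obtain ⟨l', m', k', j', hl', hm', he, h1, h2⟩ := hDist_attain hc ho hb hp hq
  rw [he]
  have a1 := h1 l k hl
  have a2 := h2 m j hm
  simp only [map_sub] at a1 a2
  have := hl p hp
  have := hl q hq
  have := hm p hp
  have := hm q hq
  have := hl' p hp
  have := hl' q hq
  have := hm' p hp
  have := hm' q hq
  gcongr ?_ * Real.log ?_
  rw [← div_mul_div_comm, ← div_mul_div_comm]
  gcongr ?_ * ?_
  · rw [div_le_div_iff₀ (by assumption) (by assumption)]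
    nlinarith
  · rw [div_le_div_iff₀ (by assumption) (by assumption)]
    nlinarith

lemma hDist_comm {C : Set (Euc 2)} (hc : Convex ℝ C) (ho : IsOpen C)
    (hb : Bornology.IsBounded C) {p q : Euc 2} (hp : p ∈ C) (hq : q ∈ C) :
    hDist C p q = hDist C q p := by
  have key : ∀ {p q : Euc 2}, p ∈ C → q ∈ C → hDist C p q ≤ hDist C q p := by
    intro p q hp hq
    obtain ⟨l, m, k, j, hl, hm, he, -, -⟩ := hDist_attain hc ho hb hp hq
    have := hDist_ge hc ho hb hq hp hm hl
    rw [he]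
    convert this using 4 <;> ring
  exact le_antisymm (key hp hq) (key hq hp)

lemma hDist_nonneg {C : Set (Euc 2)} (hc : Convex ℝ C) (ho : IsOpen C)
    (hb : Bornology.IsBounded C) {p q : Euc 2} (hp : p ∈ C) (hq : q ∈ C) :
    0 ≤ hDist C p q := by
  simpa using hDist_ge hc ho hb hp hq (PA_one C) (PA_one C)

lemma hDist_tri {C : Set (Euc 2)} (hc : Convex ℝ C) (ho : IsOpen C)
    (hb : Bornology.IsBounded C) {p q r : Euc 2} (hp : p ∈ C) (hq : q ∈ C) (hr : r ∈ C) :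
    hDist C p r ≤ hDist C p q + hDist C q r := by
  obtain ⟨l, m, k, j, hl, hm, he, -, -⟩ := hDist_attain hc ho hb hp hr
  have h1 := hDist_ge hc ho hb hp hq hl hm
  have h2 := hDist_ge hc ho hb hq hr hl hm
  have := hl p hp
  have := hl q hq
  have := hl r hr
  have := hm p hp
  have := hm q hq
  have := hm r hr
  have e : Real.log (((l p + k) * (m r + j)) / ((l r + k) * (m p + j))) =
      Real.log (((l p + k) * (m q + j)) / ((l q + k) * (m p + j))) +
      Real.log (((l q + k) * (m r + j)) / ((l r + k) * (m q + j))) := by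
    rw [← Real.log_mul (by positivity) (by positivity)]
    congr 1
    field_simp
  rw [he, e]
  linarith

lemma hDist_add {C : Set (Euc 2)} (hc : Convex ℝ C) (ho : IsOpen C)
    (hb : Bornology.IsBounded C) {p q w : Euc 2} (hp : p ∈ C) (hq : q ∈ C)
    (hw : w ∈ segment ℝ p q) :
    hDist C p w + hDist C w q = hDist C p q := by
  have hwC : w ∈ C := hc.segment_subset hp hq hw
  apply le_antisymm _ (hDist_tri hc ho hb hp hwC hq)
  obtain ⟨l, m, k, j, hl, hm, he, h1, h2⟩ := hDist_attain hc ho hb hp hq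
  rw [segment_eq_image'] at hw
  obtain ⟨s, ⟨hs0, hs1⟩, hsw⟩ := hw
  simp only at hsw
  have hqv : q = p + (q - p) := by abel
  set v := q - p with hv
  obtain ⟨l1, m1, k1, j1, hl1, hm1, he1, -, -⟩ := hDist_attain hc ho hb hp hwC
  obtain ⟨l2, m2, k2, j2, hl2, hm2, he2, -, -⟩ := hDist_attain hc ho hb hwC hq
  have ew : ∀ f : Euc 2 →L[ℝ] ℝ, f w = f p + s * f v := by
    intro f; rw [← hsw]; simp
  have eq : ∀ f : Euc 2 →L[ℝ] ℝ, f q = f p + f v := by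
    intro f; rw [hqv]; simp
  have P := fun (l : Euc 2 →L[ℝ] ℝ) (k : ℝ) (h : PA C l k) => h p hp
  have Q := fun (l : Euc 2 →L[ℝ] ℝ) (k : ℝ) (h : PA C l k) => h q hq
  have W := fun (l : Euc 2 →L[ℝ] ℝ) (k : ℝ) (h : PA C l k) => h w hwC
  have A1 : (l1 p + k1) / (l1 w + k1) ≤ (l p + k) / (l w + k) := by
    rw [div_le_div_iff₀ (W _ _ hl1) (W _ _ hl), ew, ew]
    nlinarith [mul_le_mul_of_nonneg_left (h1 l1 k1 hl1) hs0]
  have A2 : (m1 w + j1) / (m1 p + j1) ≤ (m w + j) / (m p + j) := by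
    rw [div_le_div_iff₀ (P _ _ hm1) (P _ _ hm), ew, ew]
    nlinarith [mul_le_mul_of_nonneg_left (h2 m1 j1 hm1) hs0]
  have A3 : (l2 w + k2) / (l2 q + k2) ≤ (l w + k) / (l q + k) := by
    rw [div_le_div_iff₀ (Q _ _ hl2) (Q _ _ hl), ew, ew, eq, eq]
    nlinarith [mul_le_mul_of_nonneg_left (h1 l2 k2 hl2) (sub_nonneg.mpr hs1)]
  have A4 : (m2 q + j2) / (m2 w + j2) ≤ (m q + j) / (m w + j) := by
    rw [div_le_div_iff₀ (W _ _ hm2) (W _ _ hm), ew, ew, eq, eq]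
    nlinarith [mul_le_mul_of_nonneg_left (h2 m2 j2 hm2) (sub_nonneg.mpr hs1)]
  rw [he1, he2, he, ← mul_add]
  have := P _ _ hl; have := P _ _ hm; have := P _ _ hl1; have := P _ _ hm1
  have := P _ _ hl2; have := P _ _ hm2
  have := Q _ _ hl; have := Q _ _ hm; have := Q _ _ hl1; have := Q _ _ hm1
  have := Q _ _ hl2; have := Q _ _ hm2
  have := W _ _ hl; have := W _ _ hm; have := W _ _ hl1; have := W _ _ hm1
  have := W _ _ hl2; have := W _ _ hm2
  rw [← Real.log_mul (by positivity) (by positivity)]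
  gcongr ?_ * Real.log ?_
  calc _ = ((l1 p + k1) / (l1 w + k1)) * ((m1 w + j1) / (m1 p + j1)) *
        (((l2 w + k2) / (l2 q + k2)) * ((m2 q + j2) / (m2 w + j2))) := by
        field_simp
    _ ≤ ((l p + k) / (l w + k)) * ((m w + j) / (m p + j)) *
        (((l w + k) / (l q + k)) * ((m q + j) / (m w + j))) := by gcongr
    _ = _ := by field_simp

lemma hDist_nhd {C : Set (Euc 2)} (hc : Convex ℝ C) (ho : IsOpen C)
    (hb : Bornology.IsBounded C) {w : Euc 2} (hw : w ∈ C) :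
    ∃ ρ > 0, ∀ w' ∈ Metric.ball w ρ, w' ∈ C ∧ hDist C w w' ≤ 1 := by
  obtain ⟨r, hr, hrs⟩ := Metric.isOpen_iff.mp ho w hw
  refine ⟨r / 3, by positivity, fun w' hw' => ?_⟩
  have hw'C : w' ∈ C := hrs (Metric.ball_subset_ball (by linarith) hw')
  refine ⟨hw'C, ?_⟩
  obtain ⟨l, m, k, j, hl, hm, he, -, -⟩ := hDist_attain hc ho hb hw hw'C
  have hn : ‖w' - w‖ < r / 3 := by rwa [Metric.mem_ball, dist_eq_norm] at hw'
  have i1 : w + (2 : ℝ) • (w' - w) ∈ C := by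
    apply hrs
    rw [Metric.mem_ball, dist_eq_norm]
    simp only [add_sub_cancel_left, norm_smul]
    norm_num
    linarith
  have i2 : w - (2 : ℝ) • (w' - w) ∈ C := by
    apply hrs
    rw [Metric.mem_ball, dist_eq_norm]
    have : w - (2 : ℝ) • (w' - w) - w = -((2 : ℝ) • (w' - w)) := by abel
    rw [this, norm_neg, norm_smul]
    norm_num
    linarith
  have a1 := hl _ i1
  have a2 := hm _ i2
  simp only [map_add, map_sub, map_smul, smul_eq_mul] at a1 a2
  have := hl w hw; have := hm w hw; have := hl w' hw'C; have := hm w' hw'C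
  have hle : ((l w + k) * (m w' + j)) / ((l w' + k) * (m w + j)) ≤ 2 * (3 / 2) := by
    rw [← div_mul_div_comm]
    gcongr ?_ * ?_
    · rw [div_le_iff₀ (by assumption)]; linarith
    · rw [div_le_iff₀ (by assumption)]; linarith
  rw [he]
  have h3 := Real.log_le_sub_one_of_pos (x := ((l w + k) * (m w' + j)) / ((l w' + k) * (m w + j)))
    (by positivity)
  linarith

def Slim (C : Set (Euc 2)) (δ : ℝ) : Prop :=
  ∀ x ∈ C, ∀ y ∈ C, ∀ z ∈ C, ∀ u ∈ segment ℝ x y,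
    ∃ w, (w ∈ segment ℝ z x ∨ w ∈ segment ℝ z y) ∧ hDist C u w ≤ δ

lemma slim_hyp {C : Set (Euc 2)} (hc : Convex ℝ C) (ho : IsOpen C)
    (hb : Bornology.IsBounded C) {δ : ℝ} (hδ : 0 ≤ δ) (hs : Slim C δ) :
    IsDeltaHyp C (3 * δ + 2) := by
  intro x hx y hy z hz t ht
  have sub := fun {a b : Euc 2} (ha : a ∈ C) (hb : b ∈ C) => hc.segment_subset ha hb
  choose! ρ hρ0 hρ using fun (w : Euc 2) (hw : w ∈ C) => hDist_nhd hc ho hb hw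
  let U : Euc 2 → Set (Euc 2) := fun e =>
    ⋃ (w : Euc 2) (_ : w ∈ C ∧ ∃ p ∈ segment ℝ t e, hDist C w p ≤ δ), Metric.ball w (ρ w)
  have hU : ∀ e, IsOpen (U e) := fun e =>
    isOpen_iUnion fun w => isOpen_iUnion fun _ => Metric.isOpen_ball
  have hmem : ∀ e ∈ C, ∀ w ∈ U e, w ∈ C ∧ ∃ p ∈ segment ℝ t e, hDist C w p ≤ δ + 1 := by
    intro e he w hw
    simp only [U, mem_iUnion] at hw
    obtain ⟨w0, ⟨hw0, p, hp, hd⟩, hwb⟩ := hw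
    obtain ⟨h1, h2⟩ := hρ w0 hw0 w hwb
    refine ⟨h1, p, hp, ?_⟩
    have := hDist_tri hc ho hb h1 hw0 (sub ht he hp)
    rw [hDist_comm hc ho hb h1 hw0] at this
    linarith
  have hin : ∀ e, ∀ w ∈ C, (∃ p ∈ segment ℝ t e, hDist C w p ≤ δ) → w ∈ U e := by
    intro e w hw h
    simp only [U, mem_iUnion]
    exact ⟨w, ⟨hw, h⟩, Metric.mem_ball_self (hρ0 w hw)⟩
  have hself : ∀ w, hDist C w w = 0 := fun w => by simp [hDist]
  obtain ⟨w, hwseg, hwx, hwy⟩ := (convex_segment (𝕜 := ℝ) x y).isPreconnected (U x) (U y)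
    (hU x) (hU y) (by
      intro w hw
      obtain ⟨p, hp | hp, hd⟩ := hs x hx y hy t ht w hw
      · exact Or.inl (hin x w (sub hx hy hw) ⟨p, hp, hd⟩)
      · exact Or.inr (hin y w (sub hx hy hw) ⟨p, hp, hd⟩))
    ⟨x, left_mem_segment ℝ x y, hin x x hx ⟨x, right_mem_segment ℝ t x, by rw [hself]; exact hδ⟩⟩
    ⟨y, right_mem_segment ℝ x y, hin y y hy ⟨y, right_mem_segment ℝ t y, by rw [hself]; exact hδ⟩⟩
  obtain ⟨hw, p, hp, hdp⟩ := hmem x hx w hwx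
  obtain ⟨-, q, hq, hdq⟩ := hmem y hy w hwy
  have hpC := sub ht hx hp
  have hqC := sub ht hy hq
  obtain ⟨m, hm, hdm⟩ := hs x hx y hy z hz w hwseg
  have S := fun {a b : Euc 2} (ha : a ∈ C) (hb' : b ∈ C) => hDist_comm hc ho hb ha hb'
  have T := fun {a b c : Euc 2} (ha : a ∈ C) (hb' : b ∈ C) (hc' : c ∈ C) =>
    hDist_tri hc ho hb ha hb' hc'
  have e1 := hDist_add hc ho hb ht hx hp
  have e2 := hDist_add hc ho hb ht hy hq
  have t1 := T hx hpC hy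
  have t2 := T hpC hw hy
  have t3 := T hw hqC hy
  have t4 := T ht hpC hw
  have t5 := T ht hqC hw
  rw [S hpC hx] at e1
  rw [S hpC hw] at t2 t4
  rw [S hqC hw] at t5
  have main : gromovProd (hDist C) x y t ≥ hDist C t w - 2 * (δ + 1) := by
    unfold gromovProd
    rw [S hx ht, S hy ht]
    linarith
  have key : ∀ e ∈ C, m ∈ segment ℝ z e → gromovProd (hDist C) e z t ≤ hDist C t w + δ := by
    intro e he hme
    have hmC := sub hz he hme
    have a1 := hDist_add hc ho hb hz he hme
    have a2 := T ht hmC he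
    have a3 := T ht hmC hz
    have a4 := T ht hw hmC
    unfold gromovProd
    rw [S he ht, S hz ht, S he hz]
    rw [S hmC hz] at a3
    linarith
  rcases hm with hm | hm
  · have := key x hx hm
    have := min_le_left (gromovProd (hDist C) x z t) (gromovProd (hDist C) y z t)
    linarith
  · have := key y hy hm
    have := min_le_right (gromovProd (hDist C) x z t) (gromovProd (hDist C) y z t)
    linarith

lemma config_aux {C : Set (Euc 2)} (hc : Convex ℝ C) (ho : IsOpen C)
    (hb : Bornology.IsBounded C) {x y z u : Euc 2} (hx : x ∈ C) (hy : y ∈ C) (hz : z ∈ C)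
    (hu : u ∈ C) {a b M R : ℝ} (ha : 0 ≤ a) (hb0 : 0 ≤ b) (hab : a + b = 1)
    (hue : a • x + b • y = u) (hM : 0 < M) (hR : 1 ≤ R)
    (hMM : ∀ l k, PA C l k → l z + k ≤ M * (l u + k))
    (hfar : ∀ w ∈ segment ℝ z x, R < hDist C u w) :
    ∃ l k, PA C l k ∧ (a * M) * (l x + k) + (l z + k) ≤
      (4 * Real.exp (-(2 * R))) * ((b * M) * (l y + k)) := by
  have haM : 0 ≤ a * M := by positivity
  set w : Euc 2 := (1 / (a * M + 1)) • z + (a * M / (a * M + 1)) • x with hw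
  have hwseg : w ∈ segment ℝ z x :=
    ⟨1 / (a * M + 1), a * M / (a * M + 1), by positivity, by positivity,
      by field_simp; ring, rfl⟩
  have hwC : w ∈ C := hc.segment_subset hz hx hwseg
  have hd := hfar w hwseg
  obtain ⟨l, m, k, j, hl, hm, he, -, -⟩ := hDist_attain hc ho hb hu hwC
  refine ⟨l, k, hl, ?_⟩
  have hwv : ∀ (f : Euc 2 →L[ℝ] ℝ) (c : ℝ),
      (f w + c) * (a * M + 1) = (a * M) * (f x + c) + (f z + c) := by
    intro f c
    rw [hw]
    simp only [map_add, map_smul, smul_eq_mul]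
    field_simp
    ring
  have huv : ∀ (f : Euc 2 →L[ℝ] ℝ) (c : ℝ),
      f u + c = a * (f x + c) + b * (f y + c) := by
    intro f c
    rw [← hue]
    simp only [map_add, map_smul, smul_eq_mul]
    linear_combination (-c) * hab
  have p1 := hl u hu; have p2 := hl w hwC; have p3 := hm u hu; have p4 := hm w hwC
  have p5 := hl x hx; have p6 := hl y hy; have p7 := hl z hz
  have p8 := hm x hx; have p9 := hm y hy; have p10 := hm z hz
  rw [he] at hd
  have hd2 : 2 * R < Real.log ((l u + k) * (m w + j) / ((l w + k) * (m u + j))) := by linarith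
  rw [Real.lt_log_iff_exp_lt (by positivity), lt_div_iff₀ (by positivity)] at hd2
  set E := Real.exp (2 * R) with hE
  have hE4 : 4 ≤ E := by
    have h1 : Real.exp 2 ≤ E := Real.exp_le_exp.mpr (by linarith)
    have h2 : (2 : ℝ) ≤ Real.exp 1 := by
      have := Real.add_one_le_exp (1 : ℝ); linarith
    have h3 : Real.exp 2 = Real.exp 1 * Real.exp 1 := by rw [← Real.exp_add]; norm_num
    nlinarith
  rw [Real.exp_neg, ← hE]
  have q1 : (m w + j) * (a * M + 1) ≤ 2 * M * (m u + j) := by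
    rw [hwv]
    have h1 := hMM m j hm
    have h2 : a * M * (m x + j) ≤ M * (m u + j) := by
      rw [huv m j]
      have : 0 ≤ M * (b * (m y + j)) := by positivity
      nlinarith
    linarith
  have q2 : E * ((l w + k) * (a * M + 1)) ≤ (l u + k) * (2 * M) := by
    have h1 : E * ((l w + k) * (m u + j)) * (a * M + 1) ≤
        (l u + k) * (m w + j) * (a * M + 1) :=
      mul_le_mul_of_nonneg_right hd2.le (by positivity)
    have h2 : (l u + k) * ((m w + j) * (a * M + 1)) ≤ (l u + k) * (2 * M * (m u + j)) :=
      mul_le_mul_of_nonneg_left q1 p1.le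
    have h3 : (E * ((l w + k) * (a * M + 1))) * (m u + j) ≤ ((l u + k) * (2 * M)) * (m u + j) := by
      linarith
    exact le_of_mul_le_mul_right h3 p3
  rw [hwv, huv l k] at q2
  have q3 : 0 ≤ a * M * (l x + k) := by positivity
  have : (a * M * (l x + k) + (l z + k)) * E ≤ 4 * ((b * M) * (l y + k)) := by
    nlinarith [mul_nonneg (sub_nonneg.mpr hE4) q3, mul_nonneg (sub_nonneg.mpr hE4) p7.le]
  rw [show 4 * E⁻¹ * (b * M * (l y + k)) = 4 * (b * M * (l y + k)) / E by
    field_simp, le_div_iff₀ (by linarith)]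
  exact this

lemma config {C : Set (Euc 2)} (hc : Convex ℝ C) (ho : IsOpen C)
    (hb : Bornology.IsBounded C) {x y z u : Euc 2} (hx : x ∈ C) (hy : y ∈ C) (hz : z ∈ C)
    (hu : u ∈ segment ℝ x y) {R : ℝ} (hR : 1 ≤ R)
    (hfar : ∀ w, (w ∈ segment ℝ z x ∨ w ∈ segment ℝ z y) → R < hDist C u w) :
    ∃ (A B : ℝ) (l1 l2 l3 : Euc 2 →L[ℝ] ℝ) (k1 k2 k3 : ℝ), 0 < A ∧ 0 < B ∧
      PA C l1 k1 ∧ PA C l2 k2 ∧ PA C l3 k3 ∧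
      B * (l1 x + k1) + (l1 z + k1) ≤ (4 * Real.exp (-(2 * R))) * (A * (l1 y + k1)) ∧
      A * (l2 y + k2) + (l2 z + k2) ≤ (4 * Real.exp (-(2 * R))) * (B * (l2 x + k2)) ∧
      A * (l3 y + k3) ≤ l3 z + k3 ∧ B * (l3 x + k3) ≤ l3 z + k3 := by
  have huC := hc.segment_subset hx hy hu
  obtain ⟨a, b, ha, hb0, hab, hue⟩ := hu
  obtain ⟨-, l3, -, k3, -, h3, -, -, hmax⟩ := hDist_attain hc ho hb huC hz
  have p1 := h3 u huC
  have p2 := h3 z hz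
  have p3 := h3 x hx
  have p4 := h3 y hy
  set M := (l3 z + k3) / (l3 u + k3) with hM
  have hM0 : 0 < M := by positivity
  have hMM : ∀ l k, PA C l k → l z + k ≤ M * (l u + k) := by
    intro l k hl
    have := hmax l k hl
    simp only [map_sub] at this
    rw [hM, div_mul_eq_mul_div, le_div_iff₀ p1]
    nlinarith
  have hMe : l3 z + k3 = M * (l3 u + k3) := by rw [hM]; field_simp
  have huv : l3 u + k3 = a * (l3 x + k3) + b * (l3 y + k3) := by
    rw [← hue]
    simp only [map_add, map_smul, smul_eq_mul]
    linear_combination (-k3) * hab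
  obtain ⟨l1, k1, h1, g1⟩ := config_aux hc ho hb hx hy hz huC ha hb0 hab hue hM0 hR hMM
    (fun w hw => hfar w (Or.inl hw))
  obtain ⟨l2, k2, h2, g2⟩ := config_aux hc ho hb hy hx hz huC hb0 ha (by linarith)
    (by rw [add_comm]; exact hue) hM0 hR hMM (fun w hw => hfar w (Or.inr hw))
  have hA : 0 < b * M := by
    rcases (by positivity : 0 ≤ b * M).lt_or_eq with h | h
    · exact h
    · rw [← h] at g1
      have := h1 z hz; have := h1 x hx
      have : 0 ≤ a * M * (l1 x + k1) := by positivity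
      simp at g1; linarith
  have hB : 0 < a * M := by
    rcases (by positivity : 0 ≤ a * M).lt_or_eq with h | h
    · exact h
    · rw [← h] at g2
      have := h2 z hz; have := h2 y hy
      have : 0 ≤ b * M * (l2 y + k2) := by positivity
      simp at g2; linarith
  refine ⟨b * M, a * M, l1, l2, l3, k1, k2, k3, hA, hB, h1, h2, h3, g1, g2, ?_, ?_⟩
  · rw [hMe, huv]
    have : 0 ≤ M * (a * (l3 x + k3)) := by positivity
    nlinarith
  · rw [hMe, huv]
    have : 0 ≤ M * (b * (l3 y + k3)) := by positivity
    nlinarith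

noncomputable def Sw (q : Euc 2) : ℝ := 1 + Real.exp (q 0) + Real.exp (q 1)

lemma Sw_pos (q : Euc 2) : 0 < Sw q := by unfold Sw; positivity

noncomputable def Gm (x y z q : Euc 2) : Euc 2 :=
  (Sw q)⁻¹ • (Real.exp (q 0) • y + Real.exp (q 1) • x + z)

noncomputable def GD (x y z q : Euc 2) : Euc 2 →L[ℝ] Euc 2 :=
  (EuclideanSpace.proj (𝕜 := ℝ) (0 : Fin 2)).smulRight
      ((Real.exp (q 0) / Sw q) • (y - Gm x y z q)) +
  (EuclideanSpace.proj (𝕜 := ℝ) (1 : Fin 2)).smulRight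
      ((Real.exp (q 1) / Sw q) • (x - Gm x y z q))

lemma GD_apply (x y z q v : Euc 2) : GD x y z q v =
    v 0 • ((Real.exp (q 0) / Sw q) • (y - Gm x y z q)) +
    v 1 • ((Real.exp (q 1) / Sw q) • (x - Gm x y z q)) := by
  simp [GD]

lemma Gm_hasFDerivAt (x y z q : Euc 2) : HasFDerivAt (Gm x y z) (GD x y z q) q := by
  have h0 : HasFDerivAt (fun q : Euc 2 => Real.exp (q 0))
      (Real.exp (q 0) • (EuclideanSpace.proj (𝕜 := ℝ) (0 : Fin 2))) q :=
    (EuclideanSpace.proj (𝕜 := ℝ) (0 : Fin 2)).hasFDerivAt.exp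
  have h1 : HasFDerivAt (fun q : Euc 2 => Real.exp (q 1))
      (Real.exp (q 1) • (EuclideanSpace.proj (𝕜 := ℝ) (1 : Fin 2))) q :=
    (EuclideanSpace.proj (𝕜 := ℝ) (1 : Fin 2)).hasFDerivAt.exp
  have hS : HasFDerivAt Sw
      (Real.exp (q 0) • (EuclideanSpace.proj (𝕜 := ℝ) (0 : Fin 2)) +
       Real.exp (q 1) • (EuclideanSpace.proj (𝕜 := ℝ) (1 : Fin 2))) q :=
    (h0.const_add 1).add h1
  have hSi := (hasDerivAt_inv (Sw_pos q).ne').comp_hasFDerivAt q hS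
  have hN := ((h0.smul_const y).add (h1.smul_const x)).add_const z
  have := hSi.smul hN
  refine this.congr_fderiv ?_
  ext v i
  have := (Sw_pos q).ne'
  simp [GD_apply, Gm]
  field_simp
  ring

lemma Gm_mem {C : Set (Euc 2)} (hc : Convex ℝ C) {x y z : Euc 2} (hx : x ∈ C) (hy : y ∈ C)
    (hz : z ∈ C) (q : Euc 2) : Gm x y z q ∈ C := by
  have hS := Sw_pos q
  have h : Gm x y z q = (Real.exp (q 0) / Sw q) • y + (Real.exp (q 1) / Sw q) • x
      + (1 / Sw q) • z := by
    unfold Gm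
    simp only [smul_add, smul_smul, div_eq_inv_mul, mul_one]
  rw [h]
  have h3 := hc.sum_mem (t := Finset.univ) (w := ![Real.exp (q 0) / Sw q, Real.exp (q 1) / Sw q, 1 / Sw q])
    (z := ![y, x, z]) (by
      intro i _; fin_cases i <;> simp <;> positivity)
    (by
      simp [Fin.sum_univ_three]
      field_simp
      unfold Sw; ring)
    (by intro i _; fin_cases i <;> simp [hx, hy, hz])
  simpa [Fin.sum_univ_three] using h3

lemma aff_Gm (x y z q : Euc 2) (l : Euc 2 →L[ℝ] ℝ) (k : ℝ) :
    Sw q * (l (Gm x y z q) + k) =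
      Real.exp (q 0) * (l y + k) + Real.exp (q 1) * (l x + k) + (l z + k) := by
  have hS := (Sw_pos q).ne'
  simp only [Gm, map_add, map_smul, smul_eq_mul]
  rw [mul_add, mul_inv_cancel_left₀ hS]
  unfold Sw
  ring

lemma aff_GD (x y z q v : Euc 2) (l : Euc 2 →L[ℝ] ℝ) (k : ℝ) (h : 0 < l (Gm x y z q) + k) :
    l (GD x y z q v) / (l (Gm x y z q) + k) =
      v 0 * (Real.exp (q 0) * (l y + k) / (Sw q * (l (Gm x y z q) + k)) - Real.exp (q 0) / Sw q) +
      v 1 * (Real.exp (q 1) * (l x + k) / (Sw q * (l (Gm x y z q) + k)) - Real.exp (q 1) / Sw q) := by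
  have hS := (Sw_pos q).ne'
  simp only [GD_apply, map_add, map_smul, smul_eq_mul, map_sub]
  field_simp
  ring

lemma frac_bd {b X : ℝ} (hX : 0 < X) (h : X ≤ b) : 0 ≤ X / b ∧ X / b ≤ 1 := by
  constructor
  · exact div_nonneg hX.le (hX.le.trans h)
  · exact div_le_one_of_le₀ h (hX.le.trans h)

lemma fNorm_upper {C : Set (Euc 2)} (hc : Convex ℝ C) (ho : IsOpen C)
    (hb : Bornology.IsBounded C) {x y z : Euc 2} (hx : x ∈ C) (hy : y ∈ C) (hz : z ∈ C)
    (q v : Euc 2) : fNorm C (Gm x y z q) (GD x y z q v) ≤ ‖v‖ := by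
  have hp := Gm_mem hc hx hy hz q
  obtain ⟨l, m, k, j, hl, hm, he⟩ := fNorm_eq hc ho hb (GD x y z q v) hp
  rw [aff_GD _ _ _ _ _ _ _ (hl _ hp), aff_GD _ _ _ _ _ _ _ (hm _ hp), aff_Gm, aff_Gm] at he
  have n0 : |v 0| ≤ ‖v‖ := PiLp.norm_apply_le v 0
  have n1 : |v 1| ≤ ‖v‖ := PiLp.norm_apply_le v 1
  have bd : ∀ (l : Euc 2 →L[ℝ] ℝ) (k : ℝ), PA C l k →
    (0 ≤ Real.exp (q 0) * (l y + k) / (Real.exp (q 0) * (l y + k) + Real.exp (q 1) * (l x + k) + (l z + k)) ∧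
    Real.exp (q 0) * (l y + k) / (Real.exp (q 0) * (l y + k) + Real.exp (q 1) * (l x + k) + (l z + k)) ≤ 1) ∧
    (0 ≤ Real.exp (q 1) * (l x + k) / (Real.exp (q 0) * (l y + k) + Real.exp (q 1) * (l x + k) + (l z + k)) ∧
    Real.exp (q 1) * (l x + k) / (Real.exp (q 0) * (l y + k) + Real.exp (q 1) * (l x + k) + (l z + k)) ≤ 1) := by
    intro l k hl
    have a1 := hl x hx; have a2 := hl y hy; have a3 := hl z hz
    have a4 : 0 < Real.exp (q 0) * (l y + k) := by positivity
    have a5 : 0 < Real.exp (q 1) * (l x + k) := by positivity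
    exact ⟨frac_bd a4 (by linarith), frac_bd a5 (by linarith)⟩
  obtain ⟨⟨b1, b2⟩, b3, b4⟩ := bd l k hl
  obtain ⟨⟨c1, c2⟩, c3, c4⟩ := bd m j hm
  generalize Real.exp (q 0) * (l y + k) / (Real.exp (q 0) * (l y + k) + Real.exp (q 1) * (l x + k) + (l z + k)) = r1 at *
  generalize Real.exp (q 1) * (l x + k) / (Real.exp (q 0) * (l y + k) + Real.exp (q 1) * (l x + k) + (l z + k)) = r2 at *
  generalize Real.exp (q 0) * (m y + j) / (Real.exp (q 0) * (m y + j) + Real.exp (q 1) * (m x + j) + (m z + j)) = s1 at *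
  generalize Real.exp (q 1) * (m x + j) / (Real.exp (q 0) * (m y + j) + Real.exp (q 1) * (m x + j) + (m z + j)) = s2 at *
  have d1 : v 0 * (s1 - r1) ≤ |v 0| := by
    calc v 0 * (s1 - r1) ≤ |v 0| * |s1 - r1| := by rw [← abs_mul]; exact le_abs_self _
      _ ≤ |v 0| * 1 := by gcongr; rw [abs_le]; constructor <;> linarith
      _ = _ := mul_one _
  have d2 : v 1 * (s2 - r2) ≤ |v 1| := by
    calc v 1 * (s2 - r2) ≤ |v 1| * |s2 - r2| := by rw [← abs_mul]; exact le_abs_self _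
      _ ≤ |v 1| * 1 := by gcongr; rw [abs_le]; constructor <;> linarith
      _ = _ := mul_one _
  linarith

lemma lin_aux {a b s1 s2 r1 r2 F : ℝ} (h : |a * (s1 - r1) + b * (s2 - r2)| ≤ 2 * F)
    (h1 : 16 / 17 ≤ s1) (h2 : 0 ≤ s2) (h2' : s2 ≤ 1/16) (h3' : r1 ≤ 1/16)
    (h4 : 0 ≤ r2) (h4' : r2 ≤ 1/16) : |a| * (7/8) ≤ 2 * F + |b| * (1/16) := by
  have e1 : |a| * (7/8) ≤ |a * (s1 - r1)| := by
    rw [abs_mul]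
    gcongr
    rw [abs_of_nonneg (by linarith)]
    linarith
  have e2 : |b * (s2 - r2)| ≤ |b| * (1/16) := by
    rw [abs_mul]
    gcongr
    rw [abs_le]; constructor <;> linarith
  have e3 : |a * (s1 - r1)| ≤ |a * (s1 - r1) + b * (s2 - r2)| + |b * (s2 - r2)| := by
    have := abs_sub (a * (s1 - r1) + b * (s2 - r2)) (b * (s2 - r2))
    simpa using this
  linarith

lemma fNorm_lower {C : Set (Euc 2)} (hc : Convex ℝ C) (ho : IsOpen C)
    (hb : Bornology.IsBounded C) {x y z : Euc 2} (hx : x ∈ C) (hy : y ∈ C) (hz : z ∈ C)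
    (q v : Euc 2) {l1 l2 l3 : Euc 2 →L[ℝ] ℝ} {k1 k2 k3 : ℝ}
    (h1 : PA C l1 k1) (h2 : PA C l2 k2) (h3 : PA C l3 k3)
    (g1 : 16 * (Real.exp (q 1) * (l1 x + k1) + (l1 z + k1)) ≤ Real.exp (q 0) * (l1 y + k1))
    (g2 : 16 * (Real.exp (q 0) * (l2 y + k2) + (l2 z + k2)) ≤ Real.exp (q 1) * (l2 x + k2))
    (g3 : 16 * (Real.exp (q 0) * (l3 y + k3)) ≤ l3 z + k3)
    (g4 : 16 * (Real.exp (q 1) * (l3 x + k3)) ≤ l3 z + k3) :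
    ‖v‖ ≤ 4 * fNorm C (Gm x y z q) (GD x y z q v) := by
  have hp := Gm_mem hc hx hy hz q
  have d13 := fNorm_ge hc ho hb (v := GD x y z q v) hp h1 h3
  have d31 := fNorm_ge hc ho hb (v := GD x y z q v) hp h3 h1
  have d23 := fNorm_ge hc ho hb (v := GD x y z q v) hp h2 h3
  have d32 := fNorm_ge hc ho hb (v := GD x y z q v) hp h3 h2
  rw [aff_GD _ _ _ _ _ _ _ (h1 _ hp), aff_GD _ _ _ _ _ _ _ (h3 _ hp), aff_Gm, aff_Gm] at d13 d31
  rw [aff_GD _ _ _ _ _ _ _ (h2 _ hp), aff_GD _ _ _ _ _ _ _ (h3 _ hp), aff_Gm, aff_Gm] at d23 d32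
  generalize fNorm C (Gm x y z q) (GD x y z q v) = F at *
  have pos : ∀ (l : Euc 2 →L[ℝ] ℝ) (k : ℝ), PA C l k → 0 < Real.exp (q 0) * (l y + k) ∧
      0 < Real.exp (q 1) * (l x + k) ∧ 0 < l z + k := by
    intro l k hl
    have a1 := hl x hx; have a2 := hl y hy; have a3 := hl z hz
    exact ⟨by positivity, by positivity, a3⟩
  obtain ⟨a1, a2, a3⟩ := pos l1 k1 h1
  obtain ⟨b1, b2, b3⟩ := pos l2 k2 h2
  obtain ⟨c1, c2, c3⟩ := pos l3 k3 h3
  generalize Real.exp (q 0) * (l1 y + k1) = X1 at *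
  generalize Real.exp (q 1) * (l1 x + k1) = Y1 at *
  generalize (l1 z + k1) = Z1 at *
  generalize Real.exp (q 0) * (l2 y + k2) = X2 at *
  generalize Real.exp (q 1) * (l2 x + k2) = Y2 at *
  generalize (l2 z + k2) = Z2 at *
  generalize Real.exp (q 0) * (l3 y + k3) = X3 at *
  generalize Real.exp (q 1) * (l3 x + k3) = Y3 at *
  generalize (l3 z + k3) = Z3 at *
  have A : |v 0| * (7/8) ≤ 2 * F + |v 1| * (1/16) := by
    apply lin_aux (s1 := X1 / (X1 + Y1 + Z1)) (s2 := Y1 / (X1 + Y1 + Z1))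
      (r1 := X3 / (X3 + Y3 + Z3)) (r2 := Y3 / (X3 + Y3 + Z3))
    · rw [abs_le]; constructor <;> linarith
    · rw [div_le_div_iff₀ (by norm_num) (by positivity)]; linarith
    · positivity
    · rw [div_le_div_iff₀ (by positivity) (by norm_num)]; linarith
    · rw [div_le_div_iff₀ (by positivity) (by norm_num)]; linarith
    · positivity
    · rw [div_le_div_iff₀ (by positivity) (by norm_num)]; linarith
  have B : |v 1| * (7/8) ≤ 2 * F + |v 0| * (1/16) := by
    apply lin_aux (s1 := Y2 / (X2 + Y2 + Z2)) (s2 := X2 / (X2 + Y2 + Z2))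
      (r1 := Y3 / (X3 + Y3 + Z3)) (r2 := X3 / (X3 + Y3 + Z3))
    · rw [abs_le]; constructor <;> linarith
    · rw [div_le_div_iff₀ (by norm_num) (by positivity)]; linarith
    · positivity
    · rw [div_le_div_iff₀ (by positivity) (by norm_num)]; linarith
    · rw [div_le_div_iff₀ (by positivity) (by norm_num)]; linarith
    · positivity
    · rw [div_le_div_iff₀ (by positivity) (by norm_num)]; linarith
  have A' : |v 0| ≤ 8 / 3 * F := by linarith [abs_nonneg (v 0), abs_nonneg (v 1)]
  have B' : |v 1| ≤ 8 / 3 * F := by linarith [abs_nonneg (v 0), abs_nonneg (v 1)]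
  have hF : 0 ≤ F := by linarith [abs_nonneg (v 0)]
  rw [EuclideanSpace.norm_eq]
  apply Real.sqrt_le_iff.mpr
  refine ⟨by positivity, ?_⟩
  simp only [Fin.sum_univ_two, Real.norm_eq_abs]
  nlinarith [mul_self_le_mul_self (abs_nonneg _) A', mul_self_le_mul_self (abs_nonneg _) B']

lemma exists_bump : ∃ (g : Euc 2 → ℝ) (K : ℝ≥0), ContDiff ℝ 1 g ∧ LipschitzWith K g ∧
    (∀ q, 0 ≤ g q ∧ g q ≤ 1) ∧ (∀ q, ‖q‖ ≤ 1 → g q = 1) ∧ (∀ q, 2 ≤ ‖q‖ → g q = 0) := by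
  let χ : ContDiffBump (0 : Euc 2) := ⟨1, 2, by norm_num, by norm_num⟩
  have hcd : ContDiff ℝ 1 (χ : Euc 2 → ℝ) := χ.contDiff
  obtain ⟨K, hK⟩ := ContDiff.lipschitzWith_of_hasCompactSupport χ.hasCompactSupport hcd (by norm_num)
  refine ⟨χ, K, hcd, hK, fun q => ⟨χ.nonneg, χ.le_one⟩, fun q hq => ?_, fun q hq => ?_⟩
  · apply χ.one_of_mem_closedBall
    simpa using hq
  · apply χ.zero_of_le_dist
    simpa using hq

section bary
variable (x y z : Euc 2)

noncomputable def Dl : ℝ := (y 0 - z 0) * (x 1 - z 1) - (y 1 - z 1) * (x 0 - z 0)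
noncomputable def ba (p : Euc 2) : ℝ :=
  ((p 0 - z 0) * (x 1 - z 1) - (p 1 - z 1) * (x 0 - z 0)) / Dl x y z
noncomputable def bb (p : Euc 2) : ℝ :=
  ((y 0 - z 0) * (p 1 - z 1) - (y 1 - z 1) * (p 0 - z 0)) / Dl x y z
noncomputable def bc (p : Euc 2) : ℝ := 1 - ba x y z p - bb x y z p
noncomputable def Ph (p : Euc 2) : Euc 2 :=
  !₂[Real.log (ba x y z p / bc x y z p), Real.log (bb x y z p / bc x y z p)]

variable {x y z}

lemma ba_Gm (h : Dl x y z ≠ 0) (q : Euc 2) : ba x y z (Gm x y z q) = Real.exp (q 0) / Sw q := by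
  have hS := (Sw_pos q).ne'
  unfold ba
  simp only [Gm, PiLp.smul_apply, PiLp.add_apply, smul_eq_mul]
  field_simp
  unfold Sw Dl
  ring

lemma bb_Gm (h : Dl x y z ≠ 0) (q : Euc 2) : bb x y z (Gm x y z q) = Real.exp (q 1) / Sw q := by
  have hS := (Sw_pos q).ne'
  unfold bb
  simp only [Gm, PiLp.smul_apply, PiLp.add_apply, smul_eq_mul]
  field_simp
  unfold Sw Dl
  ring

lemma bc_Gm (h : Dl x y z ≠ 0) (q : Euc 2) : bc x y z (Gm x y z q) = 1 / Sw q := by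
  have hS := (Sw_pos q).ne'
  unfold bc
  rw [ba_Gm h, bb_Gm h]
  field_simp
  unfold Sw
  ring

lemma Ph_Gm (h : Dl x y z ≠ 0) (q : Euc 2) : Ph x y z (Gm x y z q) = q := by
  have hS := (Sw_pos q).ne'
  unfold Ph
  rw [ba_Gm h, bb_Gm h, bc_Gm h]
  have : ∀ a : ℝ, a / Sw q / (1 / Sw q) = a := by intro a; field_simp
  rw [this, this, Real.log_exp, Real.log_exp]
  ext i
  fin_cases i <;> simp

lemma Gm_Ph (h : Dl x y z ≠ 0) {p : Euc 2} (ha : 0 < ba x y z p) (hb : 0 < bb x y z p)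
    (hc : 0 < bc x y z p) : Gm x y z (Ph x y z p) = p := by
  have e0 : Real.exp ((Ph x y z p) 0) = ba x y z p / bc x y z p := by
    simp only [Ph]
    exact Real.exp_log (by positivity)
  have e1 : Real.exp ((Ph x y z p) 1) = bb x y z p / bc x y z p := by
    simp only [Ph]
    exact Real.exp_log (by positivity)
  have eS : (Sw (Ph x y z p))⁻¹ = bc x y z p := by
    unfold Sw
    rw [e0, e1]
    have : 1 + ba x y z p / bc x y z p + bb x y z p / bc x y z p = 1 / bc x y z p := by
      field_simp
      unfold bc; ring
    rw [this]; simp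
  unfold Gm
  rw [e0, e1, eS]
  ext i
  simp only [PiLp.smul_apply, PiLp.add_apply, smul_eq_mul]
  have : bc x y z p * (ba x y z p / bc x y z p * y i + bb x y z p / bc x y z p * x i + z i)
    = ba x y z p * y i + bb x y z p * x i + bc x y z p * z i := by field_simp
  rw [this]
  unfold bc ba bb
  field_simp
  fin_cases i
  · simp only [Dl, Fin.zero_eta, Fin.mk_one]; ring
  · simp only [Dl, Fin.zero_eta, Fin.mk_one]; ring

lemma ba_cd : ContDiff ℝ 1 (ba x y z) := by unfold ba; fun_prop
lemma bb_cd : ContDiff ℝ 1 (bb x y z) := by unfold bb; fun_prop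
lemma bc_cd : ContDiff ℝ 1 (bc x y z) := by
  unfold bc; exact (contDiff_const.sub ba_cd).sub bb_cd

lemma Ph_cd {p : Euc 2} (ha : 0 < ba x y z p) (hb : 0 < bb x y z p)
    (hc : 0 < bc x y z p) : ContDiffAt ℝ 1 (Ph x y z) p := by
  rw [contDiffAt_euclidean]
  intro i
  fin_cases i
  · simp only [Ph]
    exact (ba_cd.contDiffAt.div bc_cd.contDiffAt hc.ne').log (div_pos ha hc).ne'
  · simp only [Ph]
    exact (bb_cd.contDiffAt.div bc_cd.contDiffAt hc.ne').log (div_pos hb hc).ne'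

lemma Dl_ne {q : Euc 2} (hinj : ∀ v, GD x y z q v = 0 → v = 0) : Dl x y z ≠ 0 := by
  intro hD
  have hS := (Sw_pos q).ne'
  set u1 := (Real.exp (q 0) / Sw q) • (y - Gm x y z q) with hu1
  set u2 := (Real.exp (q 1) / Sw q) • (x - Gm x y z q) with hu2
  have hdet : u1 0 * u2 1 - u1 1 * u2 0 = 0 := by
    have : u1 0 * u2 1 - u1 1 * u2 0 =
       Real.exp (q 0) * Real.exp (q 1) / (Sw q)^3 * Dl x y z := by
      simp only [hu1, hu2, Gm, PiLp.smul_apply, PiLp.add_apply, PiLp.sub_apply, smul_eq_mul, Dl]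
      field_simp
      unfold Sw
      ring
    rw [this, hD, mul_zero]
  have k1 := hinj !₂[u2 0, -u1 0] (by
    rw [GD_apply, ← hu1, ← hu2]
    ext i; fin_cases i
    · simp; ring
    · simp; linarith)
  have k2 := hinj !₂[u2 1, -u1 1] (by
    rw [GD_apply, ← hu1, ← hu2]
    ext i; fin_cases i
    · simp; linarith
    · simp; ring)
  have a1 : u1 0 = 0 := by simpa using congrArg (fun v : Euc 2 => v 1) k1
  have a3 : u1 1 = 0 := by simpa using congrArg (fun v : Euc 2 => v 1) k2
  have k3 := hinj !₂[1, 0] (by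
    rw [GD_apply, ← hu1, ← hu2]
    ext i; fin_cases i
    · simp [a1]
    · simp [a3])
  simpa using congrArg (fun v : Euc 2 => v 0) k3

end bary

lemma fNorm_zero {C : Set (Euc 2)} (p : Euc 2) : fNorm C p 0 = 0 := by simp [fNorm]

lemma GD_inj {C : Set (Euc 2)} {x y z q : Euc 2}
    (H : ∀ v, ‖v‖ ≤ 4 * fNorm C (Gm x y z q) (GD x y z q v)) :
    ∀ v, GD x y z q v = 0 → v = 0 := by
  intro v hv
  have := H v
  rw [hv, fNorm_zero, mul_zero] at this
  exact norm_le_zero_iff.1 this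

lemma GD_surj {x y z q : Euc 2} (hinj : ∀ v, GD x y z q v = 0 → v = 0) (u : Euc 2) :
    ∃ v, GD x y z q v = u := by
  have h1 : Function.Injective ((GD x y z q : Euc 2 →L[ℝ] Euc 2) : Euc 2 →ₗ[ℝ] Euc 2) := by
    rw [injective_iff_map_eq_zero]
    exact hinj
  exact (LinearMap.injective_iff_surjective.1 h1) u

lemma GD_det {x y z q : Euc 2} (hinj : ∀ v, GD x y z q v = 0 → v = 0) :
    (GD x y z q).det ≠ 0 := by
  intro h
  have := LinearMap.bot_lt_ker_of_det_eq_zero (f := ((GD x y z q : Euc 2 →L[ℝ] Euc 2) : Euc 2 →ₗ[ℝ] Euc 2)) h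
  rw [bot_lt_iff_ne_bot] at this
  apply this
  rw [LinearMap.ker_eq_bot']
  exact hinj

lemma omegaVol_pos : 0 < omegaVol 2 := by
  unfold omegaVol
  exact ENNReal.toReal_pos (Metric.measure_ball_pos _ _ one_pos).ne' measure_ball_lt_top.ne

lemma dens_bounds {C : Set (Euc 2)} (hc : Convex ℝ C) (ho : IsOpen C)
    (hb : Bornology.IsBounded C) {x y z : Euc 2} (hx : x ∈ C) (hy : y ∈ C) (hz : z ∈ C)
    {q : Euc 2} (H : ∀ v, ‖v‖ ≤ 4 * fNorm C (Gm x y z q) (GD x y z q v)) :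
    1 / 16 ≤ |(GD x y z q).det| * (omegaVol 2 / (volume (tangentBall C (Gm x y z q) 1)).toReal) ∧
    |(GD x y z q).det| * (omegaVol 2 / (volume (tangentBall C (Gm x y z q) 1)).toReal) ≤ 1 := by
  have hinj := GD_inj H
  have hd := abs_pos.2 (GD_det hinj)
  have s1 : GD x y z q '' Metric.ball 0 1 ⊆ tangentBall C (Gm x y z q) 1 := by
    rintro _ ⟨v, hv, rfl⟩
    have := fNorm_upper hc ho hb hx hy hz q v
    simp only [tangentBall, mem_setOf_eq]
    rw [mem_ball_zero_iff] at hv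
    linarith
  have s2 : tangentBall C (Gm x y z q) 1 ⊆ GD x y z q '' Metric.ball 0 4 := by
    intro u hu
    obtain ⟨v, rfl⟩ := GD_surj hinj u
    refine ⟨v, ?_, rfl⟩
    simp only [tangentBall, mem_setOf_eq] at hu
    rw [mem_ball_zero_iff]
    linarith [H v]
  have m1 := measure_mono (μ := (volume : Measure (Euc 2))) s1
  have m2 := measure_mono (μ := (volume : Measure (Euc 2))) s2
  rw [Measure.addHaar_image_continuousLinearMap] at m1 m2
  have hV4 : volume (Metric.ball (0 : Euc 2) 4) = ENNReal.ofReal 16 * volume (Metric.ball (0 : Euc 2) 1) := by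
    rw [Measure.addHaar_ball volume (0 : Euc 2) (by norm_num : (0:ℝ) ≤ 4)]
    congr 2
    simp
    norm_num
  rw [hV4] at m2
  have hfin : volume (Metric.ball (0 : Euc 2) 1) ≠ ⊤ := measure_ball_lt_top.ne
  have hT : volume (tangentBall C (Gm x y z q) 1) ≠ ⊤ := by
    refine ne_top_of_le_ne_top ?_ m2
    exact ENNReal.mul_ne_top ENNReal.ofReal_ne_top (ENNReal.mul_ne_top ENNReal.ofReal_ne_top hfin)
  have r1 := ENNReal.toReal_mono hT m1
  have r2 := ENNReal.toReal_mono (ENNReal.mul_ne_top ENNReal.ofReal_ne_top (ENNReal.mul_ne_top ENNReal.ofReal_ne_top hfin)) m2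
  rw [ENNReal.toReal_mul, ENNReal.toReal_ofReal (abs_nonneg _)] at r1
  rw [ENNReal.toReal_mul, ENNReal.toReal_mul, ENNReal.toReal_ofReal (abs_nonneg _), ENNReal.toReal_ofReal (by norm_num)] at r2
  have hw := omegaVol_pos
  change |(GD x y z q).det| * omegaVol 2 ≤ _ at r1
  change _ ≤ |(GD x y z q).det| * (16 * omegaVol 2) at r2
  have hp : 0 < |(GD x y z q).det| * omegaVol 2 := by positivity
  have hV := hp.trans_le r1
  rw [← mul_div_assoc]
  constructor
  · rw [le_div_iff₀ hV]; linarith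
  · rw [div_le_one hV]; exact r1

lemma hMeas_image {C : Set (Euc 2)} (hc : Convex ℝ C) (ho : IsOpen C)
    (hb : Bornology.IsBounded C) {x y z : Euc 2} (hx : x ∈ C) (hy : y ∈ C) (hz : z ∈ C)
    (hD : Dl x y z ≠ 0) {B : Set (Euc 2)} (hB : IsCompact B)
    (H : ∀ q ∈ B, ∀ v, ‖v‖ ≤ 4 * fNorm C (Gm x y z q) (GD x y z q v)) :
    volume B / 16 ≤ hMeasure C (Gm x y z '' B) ∧ hMeasure C (Gm x y z '' B) ≤ volume B := by
  have hcont : Continuous (Gm x y z) :=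
    continuous_iff_continuousAt.2 fun q => (Gm_hasFDerivAt x y z q).continuousAt
  have hS : MeasurableSet (Gm x y z '' B) := (hB.image hcont).measurableSet
  have hSC : Gm x y z '' B ⊆ C := by
    rintro _ ⟨q, -, rfl⟩; exact Gm_mem hc hx hy hz q
  have hinj : InjOn (Gm x y z) B := fun a _ b _ hab => by
    rw [← Ph_Gm hD a, ← Ph_Gm hD b, hab]
  have key : hMeasure C (Gm x y z '' B) = ∫⁻ q in B, ENNReal.ofReal
      (|(GD x y z q).det| * (omegaVol 2 / (volume (tangentBall C (Gm x y z q) 1)).toReal)) := by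
    unfold hMeasure
    rw [withDensity_apply _ hS, Measure.restrict_restrict hS, inter_eq_left.2 hSC,
      lintegral_image_eq_lintegral_abs_det_fderiv_mul volume hB.measurableSet
        (fun q _ => (Gm_hasFDerivAt x y z q).hasFDerivWithinAt) hinj]
    simp_rw [ENNReal.ofReal_mul (abs_nonneg _)]
  rw [key]
  constructor
  · calc volume B / 16 = ∫⁻ q in B, ENNReal.ofReal (1 / 16) := by
          rw [lintegral_const, Measure.restrict_apply_univ, one_div,
            ENNReal.ofReal_inv_of_pos (by norm_num), mul_comm]
          simp [div_eq_mul_inv]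
      _ ≤ _ := setLIntegral_mono' hB.measurableSet fun q hq =>
          ENNReal.ofReal_le_ofReal (dens_bounds hc ho hb hx hy hz (H q hq)).1
  · calc _ ≤ ∫⁻ q in B, 1 := setLIntegral_mono' hB.measurableSet fun q hq => by
          rw [← ENNReal.ofReal_one]
          exact ENNReal.ofReal_le_ofReal (dens_bounds hc ho hb hx hy hz (H q hq)).2
      _ = volume B := by simp

lemma dual_bound {C : Set (Euc 2)} {x y z q : Euc 2} {M : ℝ} (hM : 0 ≤ M)
    (H : ∀ v, ‖v‖ ≤ 4 * fNorm C (Gm x y z q) (GD x y z q v)) {l : Euc 2 →L[ℝ] ℝ}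
    (hl : ∀ v, |l (GD x y z q v)| ≤ M * ‖v‖) :
    |dualNorm C (Gm x y z q) l| ≤ 4 * M := by
  have hbd : ∀ u, fNorm C (Gm x y z q) u = 1 → |l u| ≤ 4 * M := by
    intro u hu
    obtain ⟨v, rfl⟩ := GD_surj (GD_inj H) u
    have h1 := H v
    rw [hu] at h1
    have := hl v
    nlinarith
  unfold dualNorm
  rcases ({u : Euc 2 | fNorm C (Gm x y z q) u = 1}).eq_empty_or_nonempty with he | ⟨u, hu⟩
  · rw [he]; simp; exact hM
  · rw [abs_le]
    constructor
    · refine le_csSup_of_le ⟨4 * M, ?_⟩ ⟨u, hu, rfl⟩ (abs_le.1 (hbd u hu)).1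
      rintro _ ⟨w, hw, rfl⟩
      exact (abs_le.1 (hbd w hw)).2
    · refine csSup_le (Set.Nonempty.image _ ⟨u, hu⟩) ?_
      rintro _ ⟨w, hw, rfl⟩
      exact (abs_le.1 (hbd w hw)).2

lemma dual_zero {C : Set (Euc 2)} {p : Euc 2} : dualNorm C p 0 = 0 := by
  unfold dualNorm
  rcases ({u : Euc 2 | fNorm C p u = 1}).eq_empty_or_nonempty with he | hne
  · rw [he]; simp
  · have : (fun u : Euc 2 => (0 : Euc 2 →L[ℝ] ℝ) u) '' {u : Euc 2 | fNorm C p u = 1} = {0} := by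
      simp only [ContinuousLinearMap.zero_apply]
      exact hne.image_const 0
    rw [this, csSup_singleton]

open Classical in
noncomputable def tf (x y z q0 : Euc 2) (L : ℝ) (g : Euc 2 → ℝ) (p : Euc 2) : ℝ :=
  if 0 < ba x y z p ∧ 0 < bb x y z p ∧ 0 < bc x y z p then g (L⁻¹ • (Ph x y z p - q0)) else 0

lemma tf_Gm {x y z : Euc 2} (hD : Dl x y z ≠ 0) (q0 : Euc 2) (L : ℝ) (g : Euc 2 → ℝ)
    (q : Euc 2) : tf x y z q0 L g (Gm x y z q) = g (L⁻¹ • (q - q0)) := by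
  have hS := Sw_pos q
  unfold tf
  rw [if_pos, Ph_Gm hD]
  rw [ba_Gm hD, bb_Gm hD, bc_Gm hD]
  exact ⟨by positivity, by positivity, by positivity⟩

lemma tf_off {x y z : Euc 2} (hD : Dl x y z ≠ 0) (q0 : Euc 2) {L : ℝ} (hL : 0 < L)
    {g : Euc 2 → ℝ} (hg : ∀ q, 2 ≤ ‖q‖ → g q = 0) {p : Euc 2}
    (hp : p ∉ Gm x y z '' Metric.closedBall q0 (2 * L)) : tf x y z q0 L g p = 0 := by
  unfold tf
  split_ifs with h
  · apply hg
    by_contra hlt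
    push Not at hlt
    apply hp
    refine ⟨Ph x y z p, ?_, Gm_Ph hD h.1 h.2.1 h.2.2⟩
    rw [norm_smul, norm_inv, Real.norm_of_nonneg hL.le, inv_mul_lt_iff₀ hL] at hlt
    rw [Metric.mem_closedBall, dist_eq_norm]
    linarith
  · rfl

lemma Gm_cont (x y z : Euc 2) : Continuous (Gm x y z) :=
  continuous_iff_continuousAt.2 fun q => (Gm_hasFDerivAt x y z q).continuousAt

lemma tf_cd {x y z : Euc 2} (hD : Dl x y z ≠ 0) (q0 : Euc 2) {L : ℝ} (hL : 0 < L)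
    {g : Euc 2 → ℝ} (hg : ∀ q, 2 ≤ ‖q‖ → g q = 0) (hcd : ContDiff ℝ 1 g) :
    ContDiff ℝ 1 (tf x y z q0 L g) := by
  rw [contDiff_iff_contDiffAt]
  intro p
  by_cases hp : p ∈ Gm x y z '' Metric.closedBall q0 (2 * L)
  · obtain ⟨q, -, rfl⟩ := hp
    have hS := Sw_pos q
    have ha : 0 < ba x y z (Gm x y z q) := by rw [ba_Gm hD]; positivity
    have hb : 0 < bb x y z (Gm x y z q) := by rw [bb_Gm hD]; positivity
    have hc : 0 < bc x y z (Gm x y z q) := by rw [bc_Gm hD]; positivity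
    have h1 : ContDiffAt ℝ 1 (fun p => g (L⁻¹ • (Ph x y z p - q0))) (Gm x y z q) := by
      refine hcd.contDiffAt.comp (Gm x y z q) ?_
      exact ((Ph_cd ha hb hc).sub contDiffAt_const).const_smul _
    refine h1.congr_of_eventuallyEq ?_
    filter_upwards [ba_cd.continuous.continuousAt.eventually (lt_mem_nhds ha),
      bb_cd.continuous.continuousAt.eventually (lt_mem_nhds hb),
      bc_cd.continuous.continuousAt.eventually (lt_mem_nhds hc)] with p h1 h2 h3
    unfold tf
    rw [if_pos ⟨h1, h2, h3⟩]
  · have hcl : IsClosed (Gm x y z '' Metric.closedBall q0 (2 * L)) :=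
      ((isCompact_closedBall _ _).image (Gm_cont x y z)).isClosed
    refine (contDiffAt_const (c := (0 : ℝ))).congr_of_eventuallyEq ?_
    filter_upwards [hcl.isOpen_compl.mem_nhds hp] with p' hp'
    exact tf_off hD q0 hL hg hp'

lemma flat_test {C : Set (Euc 2)} (hc : Convex ℝ C) (ho : IsOpen C)
    (hb : Bornology.IsBounded C) {x y z : Euc 2} (hx : x ∈ C) (hy : y ∈ C) (hz : z ∈ C)
    {g : Euc 2 → ℝ} {K : ℝ≥0} (hcd : ContDiff ℝ 1 g) (hK : LipschitzWith K g)
    (hg01 : ∀ q, 0 ≤ g q ∧ g q ≤ 1) (hg1 : ∀ q, ‖q‖ ≤ 1 → g q = 1)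
    (hg0 : ∀ q, 2 ≤ ‖q‖ → g q = 0) (q0 : Euc 2) {L : ℝ} (hL : 0 < L)
    (H : ∀ q ∈ Metric.closedBall q0 (2 * L), ∀ v,
      ‖v‖ ≤ 4 * fNorm C (Gm x y z q) (GD x y z q v)) :
    lambda1 C ≤ 1024 * (K : ℝ) ^ 2 / L ^ 2 := by
  have hq0 : q0 ∈ Metric.closedBall q0 (2 * L) := Metric.mem_closedBall_self (by positivity)
  have hD : Dl x y z ≠ 0 := Dl_ne (GD_inj (H q0 hq0))
  set S := Gm x y z '' Metric.closedBall q0 (2 * L) with hSdef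
  set S1 := Gm x y z '' Metric.closedBall q0 L with hS1def
  have hScpt : IsCompact S := (isCompact_closedBall _ _).image (Gm_cont x y z)
  have hS1cpt : IsCompact S1 := (isCompact_closedBall _ _).image (Gm_cont x y z)
  have hSC : S ⊆ C := by
    rintro _ ⟨q, -, rfl⟩; exact Gm_mem hc hx hy hz q
  have hBB : Metric.closedBall q0 L ⊆ Metric.closedBall q0 (2 * L) :=
    Metric.closedBall_subset_closedBall (by linarith)
  have hS1S : S1 ⊆ S := image_mono hBB
  set f := tf x y z q0 L g with hf
  have hfcd : ContDiff ℝ 1 f := tf_cd hD q0 hL hg0 hcd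
  have hfoff : ∀ p, p ∉ S → f p = 0 := fun p hp => tf_off hD q0 hL hg0 hp
  have hts : tsupport f ⊆ S := closure_minimal (fun p hp => by
    by_contra h; exact hp (hfoff p h)) hScpt.isClosed
  have hcs : HasCompactSupport f := HasCompactSupport.intro hScpt hfoff
  have hf01 : ∀ p, 0 ≤ f p ∧ f p ≤ 1 := by
    intro p
    rw [hf]; unfold tf
    split_ifs
    · exact hg01 _
    · norm_num
  have hf1 : ∀ p ∈ S1, f p = 1 := by
    rintro _ ⟨q, hq, rfl⟩
    rw [hf, tf_Gm hD]
    apply hg1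
    rw [norm_smul, norm_inv, Real.norm_of_nonneg hL.le, inv_mul_le_iff₀ hL, mul_one]
    rwa [Metric.mem_closedBall, dist_eq_norm] at hq
  have hq0S1 : Gm x y z q0 ∈ S1 := ⟨q0, Metric.mem_closedBall_self hL.le, rfl⟩
  have htest : f ∈ testFuns C := by
    refine ⟨ContDiff.lipschitzWith_of_hasCompactSupport hcs hfcd (by norm_num), ?_, hcs,
      hts.trans hSC⟩
    intro h0
    have := hf1 _ hq0S1
    rw [h0] at this
    simp at this
  -- dual norm bound
  set M : ℝ := K / L with hM
  have hM0 : 0 ≤ M := by positivity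
  have hdual : ∀ p ∈ S, |dualNorm C p (fderiv ℝ f p)| ≤ 4 * M := by
    rintro _ ⟨q, hq, rfl⟩
    apply dual_bound hM0 (H q hq)
    intro v
    have hchi : LipschitzWith (K * ‖L⁻¹‖₊) (fun q => g (L⁻¹ • (q - q0))) := by
      refine hK.comp ?_
      refine LipschitzWith.of_dist_le_mul fun a b => ?_
      rw [dist_smul₀, dist_sub_right]
      simp
    have e : (fun q => g (L⁻¹ • (q - q0))) = f ∘ Gm x y z := by
      ext q; simp only [Function.comp, hf, tf_Gm hD]
    have hfd : HasFDerivAt f (fderiv ℝ f (Gm x y z q)) (Gm x y z q) :=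
      (hfcd.differentiable (by norm_num) _).hasFDerivAt
    have hcomp := hfd.comp q (Gm_hasFDerivAt x y z q)
    rw [← e] at hcomp
    have hn := norm_fderiv_le_of_lipschitz ℝ hchi (x₀ := q)
    rw [hcomp.fderiv] at hn
    have := ((fderiv ℝ f (Gm x y z q)).comp (GD x y z q)).le_of_opNorm_le hn v
    simp only [ContinuousLinearMap.comp_apply, Real.norm_eq_abs] at this
    refine this.trans (le_of_eq ?_)
    rw [hM]
    simp [abs_of_pos hL, div_eq_mul_inv]
  have hdual0 : ∀ p, p ∉ S → dualNorm C p (fderiv ℝ f p) = 0 := by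
    intro p hp
    have : fderiv ℝ f p = 0 := by
      by_contra h
      exact hp (hts (support_fderiv_subset ℝ h))
    rw [this, dual_zero]
  -- measures
  obtain ⟨-, hmS⟩ := hMeas_image hc ho hb hx hy hz hD (isCompact_closedBall q0 (2 * L)) H
  obtain ⟨hmS1, -⟩ := hMeas_image hc ho hb hx hy hz hD (isCompact_closedBall q0 L)
    fun q hq => H q (hBB hq)
  set V := volume (Metric.closedBall q0 L) with hV
  have hVtop : V ≠ ⊤ := measure_closedBall_lt_top.ne
  have hVpos : 0 < V := Metric.measure_closedBall_pos _ _ hL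
  have hVr : 0 < V.toReal := ENNReal.toReal_pos hVpos.ne' hVtop
  have hV2 : volume (Metric.closedBall q0 (2 * L)) = 4 * V := by
    rw [hV, Measure.addHaar_closedBall volume q0 hL.le,
      Measure.addHaar_closedBall volume q0 (by positivity : 0 ≤ 2 * L), ← mul_assoc]
    congr 1
    rw [mul_pow, ENNReal.ofReal_mul (by positivity)]
    congr 1
    simp
    norm_num
  rw [hV2] at hmS
  set μ := (hMeasure C).restrict C with hμ
  have hμS : μ S = hMeasure C S := by
    rw [hμ, Measure.restrict_apply hScpt.measurableSet, inter_eq_left.2 hSC]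
  have hμS1 : μ S1 = hMeasure C S1 := by
    rw [hμ, Measure.restrict_apply hS1cpt.measurableSet, inter_eq_left.2 (hS1S.trans hSC)]
  have h4V : 4 * V ≠ ⊤ := ENNReal.mul_ne_top (by norm_num) hVtop
  have hSfin : μ S ≠ ⊤ := by rw [hμS]; exact ne_top_of_le_ne_top h4V hmS
  have hS1fin : μ S1 ≠ ⊤ := ne_top_of_le_ne_top hSfin (measure_mono hS1S)
  have hSr : μ.real S ≤ 4 * V.toReal := by
    have := ENNReal.toReal_mono h4V (hμS ▸ hmS)
    simpa [measureReal_def] using this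
  have hS1r : V.toReal / 16 ≤ μ.real S1 := by
    have := ENNReal.toReal_mono hS1fin (hμS1 ▸ hmS1)
    simpa [measureReal_def] using this
  have hindS : ∀ c : ℝ, Integrable (S.indicator fun _ => c) μ := fun c =>
    (integrable_indicator_iff hScpt.measurableSet).2 (integrableOn_const hSfin)
  have hindS1 : Integrable (S1.indicator fun _ => (1 : ℝ)) μ :=
    (integrable_indicator_iff hS1cpt.measurableSet).2 (integrableOn_const hS1fin)
  have hnum : ∫ p, dualNorm C p (fderiv ℝ f p) ^ 2 ∂μ ≤ (4 * M) ^ 2 * (4 * V.toReal) := by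
    calc _ ≤ ∫ p, S.indicator (fun _ => (4 * M) ^ 2) p ∂μ := by
          refine integral_mono_of_nonneg (Eventually.of_forall fun p => sq_nonneg _) (hindS _)
            (Eventually.of_forall fun p => ?_)
          by_cases hp : p ∈ S
          · simp only [indicator_of_mem hp]
            rw [← sq_abs]
            exact pow_le_pow_left₀ (abs_nonneg _) (hdual p hp) 2
          · simp only [indicator_of_notMem hp, hdual0 p hp]
            norm_num
      _ = μ.real S * (4 * M) ^ 2 := by
          rw [integral_indicator_const _ hScpt.measurableSet, smul_eq_mul]
      _ ≤ _ := by
          rw [mul_comm]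
          exact mul_le_mul_of_nonneg_left hSr (sq_nonneg _)
  have hf2int : Integrable (fun p => f p ^ 2) μ := by
    refine (hindS 1).mono' (hfcd.continuous.pow 2).aestronglyMeasurable
      (Eventually.of_forall fun p => ?_)
    by_cases hp : p ∈ S
    · simp only [indicator_of_mem hp]
      rw [Real.norm_of_nonneg (sq_nonneg _)]
      have := hf01 p
      nlinarith
    · simp [indicator_of_notMem hp, hfoff p hp]
  have hden : V.toReal / 16 ≤ ∫ p, f p ^ 2 ∂μ := by
    calc _ ≤ μ.real S1 := hS1r
      _ = ∫ p, S1.indicator (fun _ => (1 : ℝ)) p ∂μ := by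
          rw [integral_indicator_const _ hS1cpt.measurableSet, smul_eq_mul, mul_one]
      _ ≤ _ := by
          refine integral_mono hindS1 hf2int fun p => ?_
          by_cases hp : p ∈ S1
          · simp [indicator_of_mem hp, hf1 p hp]
          · simp only [indicator_of_notMem hp]
            positivity
  have hray : rayleigh C C f ≤ 1024 * (K : ℝ) ^ 2 / L ^ 2 := by
    unfold rayleigh
    have hdp : 0 < ∫ p, f p ^ 2 ∂μ := lt_of_lt_of_le (by positivity) hden
    rw [div_le_iff₀ hdp]
    refine hnum.trans ?_
    have e : (4 * M) ^ 2 * (4 * V.toReal) = 1024 * (K : ℝ) ^ 2 / L ^ 2 * (V.toReal / 16) := by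
      rw [hM]; field_simp; ring
    rw [e]
    exact mul_le_mul_of_nonneg_left hden (by positivity)
  refine le_trans ?_ hray
  unfold lambda1 lambda1D
  refine csInf_le ⟨0, ?_⟩ ⟨f, htest, rfl⟩
  rintro _ ⟨f', -, rfl⟩
  exact div_nonneg (integral_nonneg fun p => sq_nonneg _) (integral_nonneg fun p => sq_nonneg _)

/-- For every `λ > 0` there exists `δ ≥ 0` such that every bounded open
convex subset `C` of `ℝ²` with `λ₁(C) ≥ λ` is `δ`-hyperbolic for its Hilbert metric. -/
theorem stmt2 (lam : ℝ) (hlam : 0 < lam) :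
    ∃ δ : ℝ, 0 ≤ δ ∧ ∀ C : Set (Euc 2), Convex ℝ C → IsOpen C →
      Bornology.IsBounded C → C.Nonempty → lambda1 C ≥ lam → IsDeltaHyp C δ := by
  obtain ⟨g, K, hcd, hK, hg01, hg1, hg0⟩ := exists_bump
  obtain ⟨L, hL, hLlam⟩ : ∃ L : ℝ, 0 < L ∧ 1024 * (K : ℝ) ^ 2 / L ^ 2 < lam := by
    refine ⟨1024 * (K : ℝ) ^ 2 / lam + 1, by positivity, ?_⟩
    set t := 1024 * (K : ℝ) ^ 2 / lam with ht
    have ht0 : 0 ≤ t := by positivity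
    have e : 1024 * (K : ℝ) ^ 2 = t * lam := by rw [ht]; field_simp
    rw [e, div_lt_iff₀ (by positivity)]
    nlinarith [mul_nonneg ht0 hlam.le, mul_nonneg (mul_nonneg ht0 ht0) hlam.le]
  set R := 2 * L + 4 with hR
  refine ⟨3 * R + 2, by positivity, fun C hc ho hb _ hl1 => ?_⟩
  refine slim_hyp hc ho hb (by positivity) ?_
  by_contra hns
  unfold Slim at hns
  push Not at hns
  obtain ⟨x, hx, y, hy, z, hz, u, hu, hfar⟩ := hns
  obtain ⟨A, B, l1, l2, l3, k1, k2, k3, hA, hB, p1, p2, p3, c1, c2, c3, c4⟩ :=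
    config hc ho hb hx hy hz hu (by linarith : 1 ≤ R) hfar
  set q0 : Euc 2 := !₂[Real.log A - Real.log 16 - 2 * L, Real.log B - Real.log 16 - 2 * L] with hq0
  have hlt := flat_test hc ho hb hx hy hz hcd hK hg01 hg1 hg0 q0 hL (fun q hq v => by
    rw [Metric.mem_closedBall, dist_eq_norm] at hq
    have n0 : |q 0 - q0 0| ≤ 2 * L := (PiLp.norm_apply_le (q - q0) 0).trans hq
    have n1 : |q 1 - q0 1| ≤ 2 * L := (PiLp.norm_apply_le (q - q0) 1).trans hq
    have hz0 : q0 0 = Real.log A - Real.log 16 - 2 * L := by simp [hq0]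
    have hz1 : q0 1 = Real.log B - Real.log 16 - 2 * L := by simp [hq0]
    rw [hz0, abs_le] at n0
    rw [hz1, abs_le] at n1
    have gen : ∀ (D t : ℝ), 0 < D → Real.log D - Real.log 16 - 4 * L ≤ t →
        t ≤ Real.log D - Real.log 16 →
        16 * Real.exp t ≤ D ∧ D * Real.exp (-(4 * L)) ≤ 16 * Real.exp t := by
      intro D t hD h1 h2
      have a1 := Real.exp_le_exp.2 h1
      have a2 := Real.exp_le_exp.2 h2
      rw [Real.exp_sub, Real.exp_log hD, Real.exp_log (by norm_num)] at a2
      rw [sub_eq_add_neg _ (4 * L), Real.exp_add, Real.exp_sub, Real.exp_log hD,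
        Real.exp_log (by norm_num)] at a1
      constructor <;> linarith
    obtain ⟨a1, a2⟩ := gen A (q 0) hA (by linarith) (by linarith)
    obtain ⟨b1, b2⟩ := gen B (q 1) hB (by linarith) (by linarith)
    have hE : 1024 * Real.exp (-(2 * R)) ≤ Real.exp (-(4 * L)) := by
      have e : Real.exp (-(4 * L)) = Real.exp (-(2 * R)) * Real.exp 1 ^ 8 := by
        rw [← Real.exp_nat_mul, ← Real.exp_add, hR]; congr 1; push_cast; ring
      rw [e, mul_comm]
      refine mul_le_mul_of_nonneg_left ?_ (Real.exp_pos _).le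
      calc (1024 : ℝ) ≤ 2.7 ^ 8 := by norm_num
        _ ≤ Real.exp 1 ^ 8 := pow_le_pow_left₀ (by norm_num)
          (by linarith [Real.exp_one_gt_d9]) 8
    have X1 := p1 x hx
    have Y1 := p1 y hy
    have Z1 := p1 z hz
    have X2 := p2 x hx
    have Y2 := p2 y hy
    have Z2 := p2 z hz
    have X3 := p3 x hx
    have Y3 := p3 y hy
    have Z3 := p3 z hz
    have ea := Real.exp_pos (q 0)
    have eb := Real.exp_pos (q 1)
    refine fNorm_lower hc ho hb hx hy hz q v p1 p2 p3 ?_ ?_ ?_ ?_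
    · have t1 := mul_le_mul_of_nonneg_right b1 X1.le
      have t2 := mul_le_mul_of_nonneg_right a2 Y1.le
      have t3 := mul_le_mul_of_nonneg_right hE (mul_pos hA Y1).le
      have t4 := mul_pos eb X1
      nlinarith
    · have t1 := mul_le_mul_of_nonneg_right a1 Y2.le
      have t2 := mul_le_mul_of_nonneg_right b2 X2.le
      have t3 := mul_le_mul_of_nonneg_right hE (mul_pos hB X2).le
      have t4 := mul_pos ea Y2
      nlinarith
    · have t1 := mul_le_mul_of_nonneg_right a1 Y3.le
      linarith
    · have t1 := mul_le_mul_of_nonneg_right b1 X3.le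
      linarith)
  linarith
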